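/- arXiv:1110.1930 — 2 statements merged into one kernel-verified Lean document; each statement's English description precedes it below -/
import Mathlib

section
/- Let X, Y, S be finite nonempty sets, N ≥ 1, G : X^N → ℝ≥0 with Z₀ := Σ_x G(x) > 0, V₀ : S → ℝ≥0, W : Y × X × S → ℝ≥0, and V : S × Y × X × S → ℝ≥0. For y ∈ Y^N define Z(y) := Σ_{x∈X^N} G(x) · Σ_{s∈S^N} V₀(s_1) · (Π_{i=1}^N W(y_i | x_i, s_i)) · (Π_{i=1}^{N−1} V(s_{i+1} | y_i, x_i, s_i)), and p(y) := Z(y)/Z₀. Then for every n ∈ ℕ: Σ_{y∈Y^N} p(y)·Z(y)^n = (1/Z₀)·Σ over replicas (x⁰,…,xⁿ)∈(X^N)^{n+1} and (s⁰,…,sⁿ)∈(S^N)^{n+1} of (Π_{k=0}^n G(x^k)) · (Π_{k=0}^n V₀(s₁^k)) · Π_{i=1}^{N−1} [Σ_{y∈Y} Π_{k=0}^n W(y | x_i^k, s_i^k)·V(s_{i+1}^k | y, x_i^k, s_i^k)] · [Σ_{y∈Y} Π_{k=0}^n W(y | x_N^k, s_N^k)]. -/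
/-- A product of sums over a common alphabet, with the last position singled out, is a sum over
words of length `M + 1`. -/
theorem Fin.prod_sum_castSucc_mul_sum_last {R Y : Type*} [CommSemiring R] [Fintype Y] {M : ℕ}
    (A : Fin M → Y → R) (B : Y → R) :
    (∏ i, ∑ y, A i y) * ∑ y, B y =
      ∑ y : Fin (M + 1) → Y, (∏ i, A i (y i.castSucc)) * B (y (Fin.last M)) := by
  have h := Fintype.prod_sum (Fin.snoc (α := fun _ => Y → R) A B)
  simpa [Fin.prod_univ_castSucc] using h

/-- A power of a weighted double sum is a double sum over independent replicas. -/
theorem Fintype.sum_mul_sum_pow {R α β : Type*} [CommSemiring R] [Fintype α] [Fintype β]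
    (g : α → R) (h : α → β → R) (m : ℕ) :
    (∑ a, g a * ∑ b, h a b) ^ m =
      ∑ as : Fin m → α, ∑ bs : Fin m → β, (∏ k, g (as k)) * ∏ k, h (as k) (bs k) := by
  simp only [Fintype.sum_pow, Finset.prod_mul_distrib, Fintype.prod_sum, Finset.mul_sum]

/-- Replicated partition function identity for a general Markov channel with
state space `S`, blocklength `N = M + 1 ≥ 1`. Summing over the shared outputs `y` couples
the `n+1` replicas only locally, so the sum over `y ∈ Y^N` factorizes over positions. -/
theorem replica_identity_markov
    {X Y S : Type*} [Fintype X] [Nonempty X] [Fintype Y] [Nonempty Y]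
    [Fintype S] [Nonempty S]
    (M : ℕ) (G : (Fin (M + 1) → X) → ℝ) (hG : ∀ x, 0 ≤ G x)
    (hZ0 : 0 < ∑ x : Fin (M + 1) → X, G x)
    (V₀ : S → ℝ) (hV₀ : ∀ s, 0 ≤ V₀ s)
    (W : Y → X → S → ℝ) (hW : ∀ y x s, 0 ≤ W y x s)
    (V : S → Y → X → S → ℝ) (hV : ∀ s' y x s, 0 ≤ V s' y x s)
    (n : ℕ) :
    ∑ y : Fin (M + 1) → Y,
        ((∑ x : Fin (M + 1) → X, G x *
            ∑ s : Fin (M + 1) → S, V₀ (s 0) * (∏ i, W (y i) (x i) (s i)) *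
              ∏ i : Fin M, V (s i.succ) (y i.castSucc) (x i.castSucc) (s i.castSucc)) /
          (∑ x : Fin (M + 1) → X, G x)) *
        (∑ x : Fin (M + 1) → X, G x *
            ∑ s : Fin (M + 1) → S, V₀ (s 0) * (∏ i, W (y i) (x i) (s i)) *
              ∏ i : Fin M, V (s i.succ) (y i.castSucc) (x i.castSucc) (s i.castSucc)) ^ n
    = (1 / ∑ x : Fin (M + 1) → X, G x) *
        ∑ xs : Fin (n + 1) → (Fin (M + 1) → X),
          ∑ ss : Fin (n + 1) → (Fin (M + 1) → S),
            (∏ k, G (xs k)) * (∏ k, V₀ (ss k 0)) *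
              (∏ i : Fin M, ∑ y : Y, ∏ k,
                W y (xs k i.castSucc) (ss k i.castSucc) *
                  V (ss k i.succ) y (xs k i.castSucc) (ss k i.castSucc)) *
              (∑ y : Y, ∏ k, W y (xs k (Fin.last M)) (ss k (Fin.last M))) := by
  simp only [div_mul_eq_mul_div, one_mul, ← pow_succ', ← Finset.sum_div]
  congr 1
  simp only [Fintype.sum_mul_sum_pow]
  rw [Finset.sum_comm]
  refine Finset.sum_congr rfl fun xs _ => ?_
  rw [Finset.sum_comm]
  refine Finset.sum_congr rfl fun ss _ => ?_
  rw [mul_assoc, Fin.prod_sum_castSucc_mul_sum_last, Finset.mul_sum]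
  refine Finset.sum_congr rfl fun y _ => ?_
  simp only [Fin.prod_univ_castSucc (n := M), Finset.prod_mul_distrib]
  rw [Finset.prod_comm (f := fun k (i : Fin M) =>
      W (y i.castSucc) (xs k i.castSucc) (ss k i.castSucc)),
    Finset.prod_comm (f := fun k (i : Fin M) =>
      V (ss k i.succ) (y i.castSucc) (xs k i.castSucc) (ss k i.castSucc))]
  ring
end

section
/- Let X and Y be finite nonempty sets, W : X → Y → ℝ≥0, n ∈ ℕ, l ∈ ℕ, m : X → ℝ≥0, and for each x₀ ∈ X let Φ̂_{x₀} be a Borel probability measure on the simplex Δ(X) = {M : X → ℝ≥0 : Σ_z M(z) = 1}. Define m̂ : X^{n+1} → ℝ by m̂(x₀, x₁, …, x_n) = m(x₀) · ∫_{Δ(X)} Π_{i=1}^n M(x_i) dΦ̂_{x₀}(M). Then Σ_{(x₀,…,x_n)∈X^{n+1}} (Σ_{y∈Y} Π_{k=0}^n W(x_k, y)) · m̂(x₀,…,x_n)^l = Σ_{x₀∈X} m(x₀)^l · Σ_{y∈Y} W(x₀, y) · ∫_{Δ(X)^l} (Σ_{z∈X} W(z, y) · Π_{j=1}^l M_j(z))^n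 d(Φ̂_{x₀} ⊗ ⋯ ⊗ Φ̂_{x₀})(M₁, …, M_l). -/
open MeasureTheory

/-- A product of simplex coordinates is integrable against any finite measure. -/
theorem integrable_prod_stdSimplex {X ι κ : Type*} [Fintype X] [Fintype ι] [Fintype κ]
    (μ : Measure (ι → ↥(stdSimplex ℝ X))) [IsFiniteMeasure μ] (x : κ → X) :
    Integrable (fun Ms => ∏ j : ι, ∏ i : κ, (Ms j : X → ℝ) (x i)) μ := by
  refine Integrable.of_bound (C := 1) (Measurable.aestronglyMeasurable ?_) ?_
  · refine Finset.measurable_fun_prod _ fun j _ => Finset.measurable_fun_prod _ fun i _ => ?_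
    exact (measurable_pi_apply (x i)).comp (measurable_subtype_coe.comp (measurable_pi_apply j))
  · refine Filter.Eventually.of_forall fun Ms => ?_
    have h0 : ∀ j i, 0 ≤ (Ms j : X → ℝ) (x i) := fun j i => (Ms j).2.1 _
    have h1 : ∀ j i, (Ms j : X → ℝ) (x i) ≤ 1 := fun j i =>
      (mem_Icc_of_mem_stdSimplex (Ms j).2 _).2
    rw [Real.norm_of_nonneg (Finset.prod_nonneg fun j _ => Finset.prod_nonneg fun i _ => h0 j i)]
    exact Finset.prod_le_one (fun j _ => Finset.prod_nonneg fun i _ => h0 j i)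
      fun j _ => Finset.prod_le_one (fun i _ => h0 j i) fun i _ => h1 j i

/-- The `n`-th moment of the weighted sum of products of independent messages, expanded over
the states of the `n` replicas. -/
theorem integral_pow_sum_mul_prod_stdSimplex {X : Type*} [Fintype X] (w : X → ℝ) (n l : ℕ)
    (μ : Measure ↥(stdSimplex ℝ X)) [IsProbabilityMeasure μ] :
    ∫ Ms, (∑ z : X, w z * ∏ j : Fin l, (Ms j : X → ℝ) z) ^ n ∂(Measure.pi fun _ : Fin l => μ)
      = ∑ x : Fin n → X, (∏ i, w (x i)) * (∫ M, ∏ i, (M : X → ℝ) (x i) ∂μ) ^ l := by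
  classical
  have expand : ∀ Ms : Fin l → ↥(stdSimplex ℝ X),
      (∑ z : X, w z * ∏ j : Fin l, (Ms j : X → ℝ) z) ^ n
        = ∑ x : Fin n → X, (∏ i, w (x i)) * ∏ j, ∏ i, (Ms j : X → ℝ) (x i) := by
    intro Ms
    rw [Fintype.sum_pow]
    refine Finset.sum_congr rfl fun x _ => ?_
    rw [Finset.prod_mul_distrib, Finset.prod_comm]
  simp_rw [expand]
  rw [integral_finsetSum _ fun x _ => (integrable_prod_stdSimplex _ x).const_mul _]
  refine Finset.sum_congr rfl fun x _ => ?_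
  rw [integral_const_mul,
    integral_fintype_prod_eq_prod (fun _ (M : ↥(stdSimplex ℝ X)) => ∏ i, (M : X → ℝ) (x i))]
  simp

/-- Under the replica symmetric ansatz, the variable-node partition function
`Z_v` of the replicated system with channel `W` and variable degree `l` factorizes into
the replica symmetric expression `Z_v(n)`. -/
theorem replica_symmetric_variable_partition
    {X Y : Type*} [Fintype X] [Nonempty X] [Fintype Y] [Nonempty Y]
    (W : X → Y → ℝ) (hW : ∀ x y, 0 ≤ W x y) (n l : ℕ)
    (m : X → ℝ) (hm : ∀ x, 0 ≤ m x)
    (Φhat : X → Measure ↥(stdSimplex ℝ X)) [∀ x, IsProbabilityMeasure (Φhat x)] :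
    ∑ xs : Fin (n + 1) → X,
        (∑ y : Y, ∏ k, W (xs k) y) *
          (m (xs 0) * ∫ M, ∏ i : Fin n, (M : X → ℝ) (xs i.succ) ∂(Φhat (xs 0))) ^ l
    = ∑ x₀ : X, m x₀ ^ l *
        ∑ y : Y, W x₀ y *
          ∫ Ms, (∑ z : X, W z y * ∏ j : Fin l, ((Ms j : X → ℝ)) z) ^ n
            ∂(Measure.pi fun _ : Fin l => Φhat x₀) := by
  rw [← (Fin.consEquiv fun _ : Fin (n + 1) => X).sum_comp, Fintype.sum_prod_type]
  refine Finset.sum_congr rfl fun x₀ _ => ?_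
  simp only [Fin.consEquiv_apply, Fin.cons_zero, Fin.cons_succ, Fin.prod_univ_succ]
  simp_rw [integral_pow_sum_mul_prod_stdSimplex (fun z => W z _), Finset.mul_sum, Finset.sum_mul]
  rw [Finset.sum_comm]
  refine Finset.sum_congr rfl fun y _ => Finset.sum_congr rfl fun x _ => ?_
  rw [mul_pow]
  ring
end
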